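/- The set M₀(F) of elements of norm 1 in the Zorn vector-matrix algebra C(F) over a field F is closed under multiplication and contains two-sided inverses: if n(a) = 1 and n(b) = 1 then n(a ∘ b) = 1; moreover, if n(a) = 1 then the element a' = t(a) • 1 − a satisfies a ∘ a' = 1, a' ∘ a = 1 and n(a') = 1. -/

import Mathlib

/-- Underlying set of the Zorn vector-matrix (split Cayley–Dickson) algebra over `F`:
an element `(α₁, α₁₂, α₂₁, α₂)` is the 2×2 matrix with scalar diagonal entries
`α₁, α₂` and vector off-diagonal entries `α₁₂, α₂₁`. -/
abbrev ZornAlg (F : Type*) : Type _ := F × (Fin 3 → F) × (Fin 3 → F) × F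

/-- Dot product on `Fin 3 → F`. -/
def dot3 {F : Type*} [Field F] (x y : Fin 3 → F) : F := ∑ i, x i * y i

/-- Cross product on `Fin 3 → F`. -/
def cross3 {F : Type*} [Field F] (x y : Fin 3 → F) : Fin 3 → F :=
  ![x 1 * y 2 - x 2 * y 1, x 2 * y 0 - x 0 * y 2, x 0 * y 1 - x 1 * y 0]

/-- Zorn vector-matrix multiplication. -/
def zmul {F : Type*} [Field F] (a b : ZornAlg F) : ZornAlg F :=
  (a.1 * b.1 + dot3 a.2.1 b.2.2.1,
   a.1 • b.2.1 + b.2.2.2 • a.2.1 - cross3 a.2.2.1 b.2.2.1,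
   b.1 • a.2.2.1 + a.2.2.2 • b.2.2.1 + cross3 a.2.1 b.2.1,
   a.2.2.2 * b.2.2.2 + dot3 a.2.2.1 b.2.1)

/-- The unit `1 = (1, 0, 0, 1)` of the Zorn algebra. -/
def zornOne (F : Type*) [Field F] : ZornAlg F := (1, 0, 0, 1)

/-- Trace `t(a) = α₁ + α₂`. -/
def ztrace {F : Type*} [Field F] (a : ZornAlg F) : F := a.1 + a.2.2.2

/-- Norm `n(a) = α₁ α₂ − α₁₂ ⋅ α₂₁`. -/
def znorm {F : Type*} [Field F] (a : ZornAlg F) : F := a.1 * a.2.2.2 - dot3 a.2.1 a.2.2.1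

theorem dot3_eq {F : Type*} [Field F] (x y : Fin 3 → F) :
    dot3 x y = x 0 * y 0 + x 1 * y 1 + x 2 * y 2 :=
  Fin.sum_univ_three _

/-- The norm of the Zorn algebra is multiplicative. -/
theorem znorm_zmul {F : Type*} [Field F] (a b : ZornAlg F) :
    znorm (zmul a b) = znorm a * znorm b := by
  simp [znorm, zmul, dot3_eq, cross3, Matrix.vecHead, Matrix.vecTail]
  ring

theorem zmul_conj {F : Type*} [Field F] (a : ZornAlg F) :
    zmul a (ztrace a • zornOne F - a) = znorm a • zornOne F := by
  ext i
  · simp [zmul, ztrace, zornOne, znorm, dot3_eq]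
    ring
  · fin_cases i <;> simp [zmul, ztrace, zornOne, cross3] <;> ring
  · fin_cases i <;> simp [zmul, ztrace, zornOne, cross3] <;> ring
  · simp [zmul, ztrace, zornOne, znorm, dot3_eq]
    ring

theorem conj_zmul {F : Type*} [Field F] (a : ZornAlg F) :
    zmul (ztrace a • zornOne F - a) a = znorm a • zornOne F := by
  ext i
  · simp [zmul, ztrace, zornOne, znorm, dot3_eq]
    ring
  · fin_cases i <;> simp [zmul, ztrace, zornOne, cross3] <;> ring
  · fin_cases i <;> simp [zmul, ztrace, zornOne, cross3] <;> ring
  · simp [zmul, ztrace, zornOne, znorm, dot3_eq]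
    ring

theorem znorm_conj {F : Type*} [Field F] (a : ZornAlg F) :
    znorm (ztrace a • zornOne F - a) = znorm a := by
  simp [znorm, ztrace, zornOne, dot3_eq]
  ring

/-- The set `M₀(F)` of norm-one elements is closed under multiplication and under the
two-sided inverse `a' = t(a) • 1 − a`. -/
theorem zorn_norm_one_loop {F : Type*} [Field F] :
    (∀ a b : ZornAlg F, znorm a = 1 → znorm b = 1 → znorm (zmul a b) = 1) ∧
    (∀ a : ZornAlg F, znorm a = 1 →
      zmul a (ztrace a • zornOne F - a) = zornOne F ∧
      zmul (ztrace a • zornOne F - a) a = zornOne F ∧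
      znorm (ztrace a • zornOne F - a) = 1) := by
  refine ⟨fun a b ha hb => by rw [znorm_zmul, ha, hb, one_mul], fun a ha => ⟨?_, ?_, ?_⟩⟩
  · rw [zmul_conj, ha, one_smul]
  · rw [conj_zmul, ha, one_smul]
  · rw [znorm_conj, ha]
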